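/- arXiv:1702.02142 — 6 statements merged into one kernel-verified Lean document; each statement's English description precedes it below -/
import Mathlib

section
/- For every integer k ≥ 1, the directed path →P_{2^k−1} satisfies χ_r(→P_{2^k−1}) = k, and →P_{2^k−1} has a unique minimal ranking, namely the standard ranking given by f(v_i) = α + 1, where 2^α is the largest power of 2 dividing i. -/
/-- A directed graph on a subset of ℕ. -/
structure DGraph where
  verts : Set ℕ
  edges : Set (ℕ × ℕ)

/-- `l` is a directed walk in `G` from `u` to `v`. -/
def IsWalkFrom (G : DGraph) (u v : ℕ) (l : List ℕ) : Prop :=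
  l.head? = some u ∧ l.getLast? = some v ∧
    l.Chain' (fun a b => (a, b) ∈ G.edges) ∧ ∀ x ∈ l, x ∈ G.verts

/-- A `k`-ranking of `G`: labels in `{1,…,k}` and every directed path joining two
vertices with the same label contains a vertex with a larger label. -/
def IsRanking (G : DGraph) (k : ℕ) (f : ℕ → ℕ) : Prop :=
  (∀ v ∈ G.verts, 1 ≤ f v ∧ f v ≤ k) ∧
    ∀ u ∈ G.verts, ∀ v ∈ G.verts, u ≠ v → f u = f v →
      ∀ l : List ℕ, IsWalkFrom G u v l → ∃ x ∈ l, f u < f x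

/-- The rank number `χ_r(G)`. -/
noncomputable def rankNumber (G : DGraph) : ℕ := sInf {k | ∃ f : ℕ → ℕ, IsRanking G k f}

def pathEdges (η : ℕ) : Set (ℕ × ℕ) := {p | ∃ i, 1 ≤ i ∧ i + 1 ≤ η ∧ p = (i, i + 1)}

/-- The directed path `→P_η` on vertices `1,…,η`. -/
def pathP (η : ℕ) : DGraph := ⟨Set.Icc 1 η, pathEdges η⟩

/-- The directed cycle `→C_η` on vertices `1,…,η`. -/
def cycleC (η : ℕ) : DGraph := ⟨Set.Icc 1 η, pathEdges η ∪ {(η, 1)}⟩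

/-- Add a single directed edge to a digraph. -/
def addEdge (G : DGraph) (e : ℕ × ℕ) : DGraph := ⟨G.verts, insert e G.edges⟩

/-- The standard label of vertex `i`: `α + 1` where `2^α` is the largest power
of 2 dividing `i`. -/
def stdLabel (i : ℕ) : ℕ := padicValNat 2 i + 1

/-- Edge set of the direct sum graph of type I, `→G_n`. -/
def edgesI : ℕ → Set (ℕ × ℕ)
  | 0 => ∅
  | 1 => ∅
  | 2 => {(1, 2), (2, 3)}
  | n + 3 =>
      edgesI (n + 2) ∪
      (fun p : ℕ × ℕ => (p.1 + 2 ^ (n + 2), p.2 + 2 ^ (n + 2))) '' edgesI (n + 2) ∪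
      {(2 ^ (n + 2) - 1, 2 ^ (n + 2)), (2 ^ (n + 2), 2 ^ (n + 2) + 1)} ∪
      {p | ∃ j, 1 ≤ j ∧ j ≤ 2 ^ (n + 2) - 2 ∧ p = (j, 2 ^ (n + 2))} ∪
      {p | ∃ j, 2 ≤ j ∧ j ≤ 2 ^ (n + 2) - 1 ∧ p = (2 ^ (n + 2), 2 ^ (n + 2) + j)} ∪
      (fun p : ℕ × ℕ => (p.1, p.2 + 2 ^ (n + 2))) '' edgesI (n + 2)

/-- Edge set of the direct sum graph of type II, `←G_n`. -/
def edgesII : ℕ → Set (ℕ × ℕ)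
  | 0 => ∅
  | 1 => ∅
  | 2 => {(1, 2), (2, 3), (2, 1), (3, 2)}
  | n + 3 =>
      edgesII (n + 2) ∪
      (fun p : ℕ × ℕ => (p.1 + 2 ^ (n + 2), p.2 + 2 ^ (n + 2))) '' edgesII (n + 2) ∪
      {(2 ^ (n + 2) - 1, 2 ^ (n + 2)), (2 ^ (n + 2), 2 ^ (n + 2) + 1)} ∪
      {p | ∃ j, 1 ≤ j ∧ j ≤ 2 ^ (n + 2) - 1 ∧ p = (2 ^ (n + 2), j)} ∪
      {p | ∃ j, 1 ≤ j ∧ j ≤ 2 ^ (n + 2) - 1 ∧ p = (2 ^ (n + 2) + j, 2 ^ (n + 2))}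

/-- The direct sum graph of type I, `→G_n`. -/
def GI (n : ℕ) : DGraph := ⟨Set.Icc 1 (2 ^ n - 1), edgesI n⟩

/-- The direct sum graph of type II, `←G_n`. -/
def GII (n : ℕ) : DGraph := ⟨Set.Icc 1 (2 ^ n - 1), edgesII n⟩

/-- The graph `→Ω_{2^k}`. -/
def OmegaI (k : ℕ) : DGraph :=
  ⟨Set.Icc 1 (2 ^ k),
    (cycleC (2 ^ k)).edges ∪ (edgesI k \ pathEdges (2 ^ k - 1)) ∪
      {p | ∃ i, 2 ≤ i ∧ i ≤ 2 ^ k - 2 ∧ p = (2 ^ k, i)}⟩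

/-- The graph `←Ω_{2^k}`. -/
def OmegaII (k : ℕ) : DGraph :=
  ⟨Set.Icc 1 (2 ^ k),
    (cycleC (2 ^ k)).edges ∪ (edgesII k \ pathEdges (2 ^ k - 1)) ∪
      {p | ∃ i, 2 ≤ i ∧ i ≤ 2 ^ k - 2 ∧ p = (i, 2 ^ k)}⟩

/-- Stirling numbers of the second kind. -/
def stirling : ℕ → ℕ → ℕ
  | 0, 0 => 1
  | 0, _ + 1 => 0
  | _ + 1, 0 => 0
  | n + 1, k + 1 => (k + 1) * stirling n (k + 1) + stirling n k

/-- Attach the directed path `→P_j^{v_i}` (directed toward `vi`) to `G`,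
using `w 1, …, w (j-1)` as the new vertices and `vi` in place of `w j`. -/
def attachFwd (G : DGraph) (vi j : ℕ) (w : ℕ → ℕ) : DGraph :=
  ⟨G.verts ∪ w '' Set.Icc 1 (j - 1),
    G.edges ∪ {p | ∃ l, 1 ≤ l ∧ l + 1 ≤ j ∧
      p = (w l, if l + 1 = j then vi else w (l + 1))}⟩

/-- Attach the directed path `←P_j^{v_i}` (directed away from `vi`) to `G`. -/
def attachBwd (G : DGraph) (vi j : ℕ) (w : ℕ → ℕ) : DGraph :=
  ⟨G.verts ∪ w '' Set.Icc 1 (j - 1),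
    G.edges ∪ {p | ∃ l, 1 ≤ l ∧ l + 1 ≤ j ∧
      p = ((if l + 1 = j then vi else w (l + 1)), w l)}⟩

/-- Interval version of rankings, on `a+1, …, a+n`. -/
def RI (a n k : ℕ) (f : ℕ → ℕ) : Prop :=
  (∀ v, a < v → v ≤ a + n → 1 ≤ f v ∧ f v ≤ k) ∧
  ∀ u v, a < u → u < v → v ≤ a + n → f u = f v → ∃ x, u ≤ x ∧ x ≤ v ∧ f u < f x

theorem RI.split {a n k : ℕ} {f : ℕ → ℕ} (h : RI a n (k+1) f) :
    RI a n k f ∨ ∃ m, a < m ∧ m ≤ a + n ∧ f m = k + 1 ∧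
      RI a (m - a - 1) k f ∧ RI m (a + n - m) k f := by
  obtain ⟨h1, h2⟩ := h
  by_cases hm : ∃ m, a < m ∧ m ≤ a + n ∧ f m = k + 1
  · right
    obtain ⟨m, ham, hmn, hfm⟩ := hm
    refine ⟨m, ham, hmn, hfm, ⟨?_, ?_⟩, ⟨?_, ?_⟩⟩
    · intro v hv hv'
      have := h1 v hv (by omega)
      refine ⟨this.1, ?_⟩
      by_contra hc
      obtain ⟨x, hx1, hx2, hx3⟩ := h2 v m hv (by omega) hmn (by omega)
      have := h1 x (by omega) (by omega)
      omega
    · intro u v h3 h4 h5 h6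
      exact h2 u v h3 h4 (by omega) h6
    · intro v hv hv'
      have := h1 v (by omega) (by omega)
      refine ⟨this.1, ?_⟩
      by_contra hc
      obtain ⟨x, hx1, hx2, hx3⟩ := h2 m v ham (by omega) (by omega) (by omega)
      have := h1 x (by omega) (by omega)
      omega
    · intro u v h3 h4 h5 h6
      exact h2 u v (by omega) h4 (by omega) h6
  · left
    refine ⟨fun v hv hv' => ?_, h2⟩
    have := h1 v hv hv'
    have h3 : f v ≠ k + 1 := fun hc => hm ⟨v, hv, hv', hc⟩
    omega

theorem RI.lt {k : ℕ} : ∀ {a n : ℕ} {f : ℕ → ℕ}, RI a n k f → n < 2 ^ k := by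
  induction k with
  | zero =>
    intro a n f h
    by_contra hc
    have := h.1 (a+1) (by omega) (by simp at hc; omega)
    omega
  | succ k ih =>
    intro a n f h
    rw [pow_succ]
    rcases h.split with h | ⟨m, h1, h2, -, h3, h4⟩
    · have := ih h
      omega
    · have := ih h3
      have := ih h4
      omega

theorem stdLabel_odd (k c : ℕ) : stdLabel (2 ^ k * (2 * c + 1)) = k + 1 := by
  unfold stdLabel
  rw [padicValNat.mul (by positivity) (by omega), padicValNat.prime_pow,
    padicValNat.eq_zero_of_not_dvd (by omega)]

theorem RI.unique {k : ℕ} : ∀ {a : ℕ} {f : ℕ → ℕ}, 2 ^ k ∣ a → RI a (2 ^ k - 1) k f →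
    ∀ v, a < v → v < a + 2 ^ k → f v = stdLabel v := by
  induction k with
  | zero => intro a f _ _ v h1 h2; simp at h2; omega
  | succ k ih =>
    intro a f ha h v hv hv'
    have hp : 0 < 2 ^ k := by positivity
    have hs : 2 ^ (k+1) = 2 ^ k * 2 := pow_succ _ _
    rcases h.split with h | ⟨m, h1, h2, hfm, h3, h4⟩
    · have := h.lt
      omega
    · have l3 := h3.lt
      have l4 := h4.lt
      have hm : m = a + 2 ^ k := by omega
      obtain ⟨c, hc⟩ := ha
      have hd : 2 ^ k ∣ a := ⟨2 * c, by rw [hc, hs]; ring⟩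
      rcases lt_trichotomy v m with hlt | heq | hgt
      · have e : m - a - 1 = 2 ^ k - 1 := by omega
        rw [e] at h3
        exact ih hd h3 v hv (by omega)
      · subst heq
        rw [hfm, hm, hc, hs, show 2 ^ k * 2 * c + 2 ^ k = 2 ^ k * (2 * c + 1) by ring,
          stdLabel_odd]
      · have e : a + (2 ^ (k+1) - 1) - m = 2 ^ k - 1 := by omega
        rw [e] at h4
        exact ih (by rw [hm]; exact dvd_add hd dvd_rfl) h4 v hgt (by omega)

theorem RI_std (k : ℕ) : RI 0 (2 ^ k - 1) k stdLabel := by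
  have hp : 0 < 2 ^ k := by positivity
  constructor
  · intro v hv hv'
    obtain ⟨e, c, ⟨d, hd⟩, rfl⟩ := Nat.exists_eq_two_pow_mul_odd (n := v) (by omega)
    subst hd
    rw [stdLabel_odd]
    have h1 : 2 ^ e < 2 ^ k := by nlinarith [Nat.zero_le (2 ^ e * d), (by omega : 2 ^ e * (2 * d + 1) < 2 ^ k)]
    have := (Nat.pow_lt_pow_iff_right (a := 2) (by omega)).1 h1
    omega
  · intro u v hu huv hv h
    obtain ⟨e, c, ⟨d, hd⟩, rfl⟩ := Nat.exists_eq_two_pow_mul_odd (n := u) (by omega)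
    obtain ⟨e', c', ⟨d', hd'⟩, rfl⟩ := Nat.exists_eq_two_pow_mul_odd (n := v) (by omega)
    subst hd hd'
    rw [stdLabel_odd, stdLabel_odd] at h
    obtain rfl : e = e' := by omega
    have hlt := Nat.lt_of_mul_lt_mul_left huv
    refine ⟨2 ^ e * (2 * d + 2), Nat.mul_le_mul_left _ (by omega),
      Nat.mul_le_mul_left _ (by omega), ?_⟩
    rw [stdLabel_odd, show 2 ^ e * (2 * d + 2) = 2 ^ (e+1) * (d + 1) by ring]
    unfold stdLabel
    rw [padicValNat.mul (by positivity) (by omega), padicValNat.prime_pow]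
    omega

theorem walk_eq {η : ℕ} : ∀ {l : List ℕ} {u : ℕ}, l.head? = some u →
    l.IsChain (fun a b => (a, b) ∈ pathEdges η) → l = List.range' u l.length := by
  intro l
  induction l with
  | nil => intro u h; simp at h
  | cons x t ih =>
    intro u h hc
    simp at h
    subst h
    cases t with
    | nil => simp
    | cons y t =>
      rw [List.isChain_cons_cons] at hc
      obtain ⟨⟨i, _, _, hi⟩, hc⟩ := hc
      simp only [Prod.mk.injEq] at hi
      obtain ⟨rfl, rfl⟩ := hi
      have := ih (u := x + 1) (by simp) hc
      rw [List.length_cons, List.range'_succ, ← this]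

theorem walk_mem {η u v : ℕ} {l : List ℕ} (h : IsWalkFrom (pathP η) u v l) :
    u ≤ v ∧ ∀ x, x ∈ l ↔ u ≤ x ∧ x ≤ v := by
  obtain ⟨h1, h2, h3, -⟩ := h
  have e := walk_eq h1 h3
  have hl : l.length ≠ 0 := by
    intro h
    rw [List.length_eq_zero_iff] at h
    simp [h] at h1
  generalize l.length = n at e hl
  subst e
  rw [List.getLast?_range'] at h2
  simp [hl] at h2
  refine ⟨by omega, fun x => ?_⟩
  simp
  omega

theorem isRanking_iff (η k : ℕ) (f : ℕ → ℕ) : IsRanking (pathP η) k f ↔ RI 0 η k f := by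
  constructor
  · rintro ⟨h1, h2⟩
    refine ⟨fun v hv hv' => h1 v ⟨hv, by omega⟩, fun u v hu huv hv hf => ?_⟩
    have hw : IsWalkFrom (pathP η) u v (List.range' u (v - u + 1)) := by
      refine ⟨by rw [List.range'_succ]; rfl, ?_, ?_, ?_⟩
      · rw [List.getLast?_range']
        simp
        omega
      · show List.IsChain _ _
        rw [List.isChain_iff_getElem]
        intro i hi
        simp at hi
        refine ⟨u + i, by omega, by omega, ?_⟩
        simp
        omega
      · intro x hx
        simp at hx
        exact ⟨by omega, by omega⟩
    obtain ⟨x, hx, hx'⟩ := h2 u ⟨hu, by omega⟩ v ⟨by omega, by omega⟩ (by omega) hf _ hw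
    simp at hx
    exact ⟨x, by omega, by omega, hx'⟩
  · rintro ⟨h1, h2⟩
    refine ⟨fun v hv => h1 v hv.1 (by have := hv.2; omega), fun u hu v hv hne hf l hl => ?_⟩
    obtain ⟨huv, hm⟩ := walk_mem hl
    obtain ⟨x, hx1, hx2, hx3⟩ := h2 u v hu.1 (by omega) (by have := hv.2; omega) hf
    exact ⟨x, (hm x).2 ⟨hx1, hx2⟩, hx3⟩

/-- For every `k ≥ 1`, `χ_r(→P_{2^k−1}) = k`, and `→P_{2^k−1}` has a
unique minimal ranking, namely the standard ranking `f(v_i) = α + 1` where `2^α`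
is the largest power of 2 dividing `i`. -/
theorem stmt_0 (k : ℕ) (hk : 1 ≤ k) :
    rankNumber (pathP (2 ^ k - 1)) = k ∧
    IsRanking (pathP (2 ^ k - 1)) k stdLabel ∧
    ∀ f : ℕ → ℕ, IsRanking (pathP (2 ^ k - 1)) k f →
      ∀ v ∈ (pathP (2 ^ k - 1)).verts, f v = stdLabel v := by
  have hp : 0 < 2 ^ k := by positivity
  have hs := (isRanking_iff _ _ _).2 (RI_std k)
  refine ⟨?_, hs, fun f hf v hv => ?_⟩
  · apply le_antisymm
    · exact Nat.sInf_le ⟨_, hs⟩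
    · refine le_csInf ⟨k, _, hs⟩ ?_
      rintro j ⟨f, hf⟩
      have := ((isRanking_iff _ _ _).1 hf).lt
      exact (Nat.pow_le_pow_iff_right (a := 2) (by omega)).1 (by omega)
  · have h2 : v ≤ 2 ^ k - 1 := hv.2
    exact RI.unique (dvd_zero _) ((isRanking_iff _ _ _).1 hf) v hv.1 (by omega)
end

section
/- For every integer k ≥ 1, the directed cycle →C_{2^k} satisfies χ_r(→C_{2^k}) = k + 1, and its minimal ranking is unique up to rotation of the cycle: in any minimal ranking exactly one vertex receives label k+1, and some rotation of the ranking equals the standard ranking that labels v_i by α + 1 (where 2^α is the largest power of 2 dividing i) for 1 ≤ i ≤ 2^k−1 and labels v_{2^k} by k+1. -/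
/-- The standard minimal ranking of the directed cycle `→C_{2^k}`. -/
def stdCycleLabel (k i : ℕ) : ℕ := if i = 2 ^ k then k + 1 else stdLabel i

lemma aux_path (m : ℕ) : ∀ (L : ℕ) (g : ℕ → ℕ),
    (∀ i, 1 ≤ i → i ≤ L → 1 ≤ g i ∧ g i ≤ m) →
    (∀ i j, 1 ≤ i → i < j → j ≤ L → g i = g j → ∃ x, i ≤ x ∧ x ≤ j ∧ g i < g x) →
    L < 2 ^ m ∧ (L + 1 = 2 ^ m → ∀ i, 1 ≤ i → i ≤ L → g i = padicValNat 2 i + 1) := by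
  induction m with
  | zero =>
    intro L g h1 h2
    have : L = 0 := by
      by_contra h
      have := h1 1 le_rfl (by omega)
      omega
    subst this
    refine ⟨by norm_num, fun _ i _ _ => by omega⟩
  | succ m ih =>
    intro L g h1 h2
    have hpos : 0 < 2 ^ m := by positivity
    have hps : 2 ^ (m + 1) = 2 * 2 ^ m := by rw [pow_succ]; ring
    by_cases hp : ∃ p, 1 ≤ p ∧ p ≤ L ∧ g p = m + 1
    · obtain ⟨p, hp1, hpL, hpg⟩ := hp
      have hne : ∀ i, 1 ≤ i → i ≤ L → i ≠ p → g i ≤ m := by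
        intro i hi1 hiL hip
        by_contra hc
        have hgi : g i = m + 1 := by have := h1 i hi1 hiL; omega
        rcases lt_or_gt_of_ne hip with h | h
        · obtain ⟨x, hx1, hx2, hx3⟩ := h2 i p hi1 h hpL (by omega)
          have := h1 x (by omega) (by omega)
          omega
        · obtain ⟨x, hx1, hx2, hx3⟩ := h2 p i hp1 h hiL (by omega)
          have := h1 x (by omega) (by omega)
          omega
      obtain ⟨hl, hl'⟩ := ih (p - 1) g
        (fun i a b => ⟨(h1 i a (by omega)).1, hne i a (by omega) (by omega)⟩)
        (fun i j a b c d => h2 i j a b (by omega) d)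
      obtain ⟨hr, hr'⟩ := ih (L - p) (fun i => g (p + i))
        (fun i a b => ⟨(h1 (p + i) (by omega) (by omega)).1,
          hne (p + i) (by omega) (by omega) (by omega)⟩)
        (fun i j a b c d => by
          obtain ⟨x, hx1, hx2, hx3⟩ := h2 (p + i) (p + j) (by omega) (by omega) (by omega) d
          exact ⟨x - p, by omega, by omega, by
            have : p + (x - p) = x := by omega
            simpa [this] using hx3⟩)
      refine ⟨by omega, fun hL i hi1 hiL => ?_⟩
      have hpm : p = 2 ^ m := by omega
      rcases lt_trichotomy i p with h | h | h
      · exact hl' (by omega) i hi1 (by omega)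
      · subst h
        rw [hpg, hpm, padicValNat.prime_pow]
      · have h3 := hr' (by omega) (i - p) (by omega) (by omega)
        have h4 : p + (i - p) = i := by omega
        simp only [h4] at h3
        rw [h3]
        have h5 : padicValNat 2 (i - p) < padicValNat 2 p := by
          rw [hpm, padicValNat.prime_pow]
          have h6 : 2 ^ padicValNat 2 (i - 2 ^ m) ∣ (i - 2 ^ m) := pow_padicValNat_dvd
          have h7 := Nat.le_of_dvd (by omega) h6
          exact (Nat.pow_lt_pow_iff_right (a := 2) (by norm_num)).1 (by omega)
        congr 1
        obtain ⟨a, ha⟩ : ∃ a, a = padicValNat 2 (i - p) := ⟨_, rfl⟩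
        rw [← ha] at h5 ⊢
        have d1 : 2 ^ a ∣ i - p := by rw [ha]; exact pow_padicValNat_dvd
        have d2 : ¬ 2 ^ (a + 1) ∣ i - p := by
          rw [ha]; exact pow_succ_padicValNat_not_dvd (by omega)
        have e2 : 2 ^ (a + 1) ∣ p := by
          rw [hpm]; apply pow_dvd_pow
          rw [hpm, padicValNat.prime_pow] at h5; omega
        have e1 : 2 ^ a ∣ p := dvd_trans (pow_dvd_pow _ (by omega)) e2
        have f1 : 2 ^ a ∣ i := by rw [← h4]; exact dvd_add e1 d1
        have f2 : ¬ 2 ^ (a + 1) ∣ i := fun h => d2 (Nat.dvd_sub h e2)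
        have g1 : a ≤ padicValNat 2 i := (padicValNat_dvd_iff_le (by omega)).1 f1
        have g2 : ¬ a + 1 ≤ padicValNat 2 i :=
          fun h => f2 ((padicValNat_dvd_iff_le (by omega)).2 h)
        omega
    · push Not at hp
      obtain ⟨hl, -⟩ := ih L g
        (fun i a b => ⟨(h1 i a b).1, by have := h1 i a b; have := hp i a b; omega⟩) h2
      exact ⟨by omega, fun _ => by omega⟩

lemma aux_walk (N : ℕ) (hN : 1 ≤ N) (t n : ℕ) :
    IsWalkFrom (cycleC N) (t % N + 1) ((t + n) % N + 1)
      ((List.range (n + 1)).map (fun s => (t + s) % N + 1)) := by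
  refine ⟨?_, ?_, ?_, ?_⟩
  · simp [List.range_succ_eq_map]
  · simp [List.range_succ]
  · show List.IsChain _ _
    rw [List.isChain_map, List.isChain_iff_getElem]
    intro i hi
    simp only [List.getElem_range]
    have h1 : (t + i) % N < N := Nat.mod_lt _ (by omega)
    simp only [cycleC, pathEdges, Set.mem_union, Set.mem_setOf_eq, Set.mem_singleton_iff,
      Prod.mk.injEq]
    by_cases h : (t + i) % N + 1 = N
    · right
      refine ⟨h, ?_⟩
      have e : (t + (i + 1)) = (t + i) % N + 1 + N * ((t + i) / N) := by
        have := Nat.mod_add_div (t + i) N; omega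
      rw [e, Nat.add_mul_mod_self_left, h, Nat.mod_self]
    · left
      refine ⟨(t + i) % N + 1, by omega, by omega, rfl, ?_⟩
      have e : (t + (i + 1)) = (t + i) % N + 1 + N * ((t + i) / N) := by
        have := Nat.mod_add_div (t + i) N; omega
      rw [e, Nat.add_mul_mod_self_left, Nat.mod_eq_of_lt (by omega)]
  · intro x hx
    simp only [List.mem_map] at hx
    obtain ⟨s, -, rfl⟩ := hx
    have h1 : (t + s) % N < N := Nat.mod_lt _ (by omega)
    simp only [cycleC, Set.mem_Icc]
    omega

lemma aux_between (N K : ℕ) (hN : 1 ≤ N) (f : ℕ → ℕ) (hf : IsRanking (cycleC N) K f)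
    (r i j : ℕ) (h1 : 1 ≤ i) (hij : i < j) (hjN : j ≤ N)
    (h : f ((i + r - 1) % N + 1) = f ((j + r - 1) % N + 1)) :
    ∃ x, i ≤ x ∧ x ≤ j ∧ f ((i + r - 1) % N + 1) < f ((x + r - 1) % N + 1) := by
  have hv : ∀ t, t % N + 1 ∈ (cycleC N).verts := by
    intro t
    have h1 : t % N < N := Nat.mod_lt _ (by omega)
    simp only [cycleC, Set.mem_Icc]
    omega
  have hw := aux_walk N hN (i + r - 1) (j - i)
  have e : i + r - 1 + (j - i) = j + r - 1 := by omega
  rw [e] at hw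
  have hne : (i + r - 1) % N + 1 ≠ (j + r - 1) % N + 1 := by
    intro hc
    have hc' : (i + r - 1) ≡ (j + r - 1) [MOD N] := by
      show _ % _ = _ % _
      omega
    have hd := (Nat.modEq_iff_dvd' (by omega)).1 hc'
    have := Nat.le_of_dvd (by omega) hd
    omega
  obtain ⟨x, hx, hlt⟩ := hf.2 _ (hv _) _ (hv _) hne h _ hw
  simp only [List.mem_map, List.mem_range] at hx
  obtain ⟨s, hs, rfl⟩ := hx
  refine ⟨i + s, by omega, by omega, ?_⟩
  have e : i + r - 1 + s = i + s + r - 1 := by omega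
  rwa [e] at hlt

lemma aux_lower (k K : ℕ) (f : ℕ → ℕ) (hf : IsRanking (cycleC (2 ^ k)) K f) : k < K := by
  have hN : 1 ≤ 2 ^ k := Nat.one_le_two_pow
  have h := (aux_path K (2 ^ k) (fun i => f ((i + 0 - 1) % 2 ^ k + 1))
    (fun i _ _ => hf.1 _ (by
      have h1 : (i + 0 - 1) % 2 ^ k < 2 ^ k := Nat.mod_lt _ (by omega)
      simp only [cycleC, Set.mem_Icc]
      omega))
    (fun i j a b c d => aux_between _ K hN f hf 0 i j a b c d)).1
  exact (Nat.pow_lt_pow_iff_right (a := 2) (by norm_num)).1 h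

lemma aux_chain : ∀ (l : List ℕ) (u v : ℕ), l.head? = some u → l.getLast? = some v →
    l.IsChain (fun a b => b = a + 1) → u ≤ v ∧ ∀ x, u ≤ x → x ≤ v → x ∈ l
  | [], u, v, h, _, _ => by simp at h
  | [a], u, v, h, h', _ => by
    simp at h h'
    subst h; subst h'
    exact ⟨le_rfl, fun x _ _ => by simp; omega⟩
  | a :: b :: l, u, v, h, h', hc => by
    simp only [List.head?_cons, Option.some.injEq] at h
    subst h
    rw [List.isChain_cons_cons] at hc
    obtain ⟨h1, h2⟩ := aux_chain (b :: l) b v (by simp) (by simpa using h') hc.2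
    refine ⟨by omega, fun x hx hx' => ?_⟩
    by_cases hxa : x = a
    · simp [hxa]
    · exact List.mem_cons_of_mem _ (h2 x (by omega) hx')

lemma aux_val_lt (k i : ℕ) (h1 : 1 ≤ i) (h : i < 2 ^ k) : padicValNat 2 i < k := by
  have h6 : 2 ^ padicValNat 2 i ∣ i := pow_padicValNat_dvd
  have h7 := Nat.le_of_dvd (by omega) h6
  exact (Nat.pow_lt_pow_iff_right (a := 2) (by norm_num)).1 (by omega)

lemma aux_val_between (u v : ℕ) (h1 : 1 ≤ u) (huv : u < v)
    (h : padicValNat 2 u = padicValNat 2 v) :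
    ∃ x, u < x ∧ x < v ∧ padicValNat 2 u < padicValNat 2 x := by
  obtain ⟨a, ha⟩ : ∃ a, a = padicValNat 2 u := ⟨_, rfl⟩
  have d1 : 2 ^ a ∣ u := by rw [ha]; exact pow_padicValNat_dvd
  have d2 : ¬ 2 ^ (a + 1) ∣ u := by
    rw [ha]; exact pow_succ_padicValNat_not_dvd (by omega)
  have e1 : 2 ^ a ∣ v := by rw [ha, h]; exact pow_padicValNat_dvd
  have e2 : ¬ 2 ^ (a + 1) ∣ v := by
    rw [ha, h]; exact pow_succ_padicValNat_not_dvd (by omega)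
  obtain ⟨c, rfl⟩ := d1
  obtain ⟨d, rfl⟩ := e1
  have hp : 0 < 2 ^ a := by positivity
  rw [pow_succ, Nat.mul_dvd_mul_iff_left hp] at d2 e2
  have hcd : c < d := lt_of_mul_lt_mul_left huv (Nat.zero_le _)
  refine ⟨2 ^ a * (c + 1), ?_, ?_, ?_⟩
  · exact Nat.mul_lt_mul_of_pos_left (by omega) hp
  · exact Nat.mul_lt_mul_of_pos_left (by omega) hp
  · rw [← ha]
    apply (padicValNat_dvd_iff_le (p := 2) (by positivity)).1
    rw [pow_succ, Nat.mul_dvd_mul_iff_left hp]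
    omega

lemma aux_std (k : ℕ) : IsRanking (cycleC (2 ^ k)) (k + 1) (stdCycleLabel k) := by
  have hlt : ∀ v ∈ (cycleC (2 ^ k)).verts, v ≠ 2 ^ k → 1 ≤ v ∧ v < 2 ^ k ∧
      stdCycleLabel k v = padicValNat 2 v + 1 ∧ padicValNat 2 v < k := by
    intro v hv hne
    simp only [cycleC, Set.mem_Icc] at hv
    exact ⟨hv.1, by omega, by simp [stdCycleLabel, stdLabel, hne],
      aux_val_lt k v hv.1 (by omega)⟩
  have htop : stdCycleLabel k (2 ^ k) = k + 1 := by simp [stdCycleLabel]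
  refine ⟨?_, ?_⟩
  · intro v hv
    by_cases h : v = 2 ^ k
    · subst h; omega
    · have := hlt v hv h
      omega
  · intro u hu v hv huv hfe l hl
    by_contra hc
    push Not at hc
    have hu' : u ≠ 2 ^ k := by
      rintro rfl
      have := hlt v hv huv.symm
      omega
    have hv' : v ≠ 2 ^ k := by
      rintro rfl
      have := hlt u hu huv
      omega
    obtain ⟨hu1, hu2, hu3, hu4⟩ := hlt u hu hu'
    obtain ⟨hv1, hv2, hv3, hv4⟩ := hlt v hv hv'
    have hN : 2 ^ k ∉ l := by
      intro h
      have := hc _ h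
      omega
    obtain ⟨hl1, hl2, hl3, hl4⟩ := hl
    have hl3' : l.IsChain (fun a b => b = a + 1) := by
      have hl3 : List.IsChain _ l := hl3
      rw [List.isChain_iff_getElem] at hl3 ⊢
      intro i hi
      have h := hl3 i hi
      simp only [cycleC, pathEdges, Set.mem_union, Set.mem_setOf_eq, Set.mem_singleton_iff,
        Prod.mk.injEq] at h
      rcases h with ⟨s, _, _, h1, h2⟩ | ⟨h1, h2⟩
      · omega
      · exact absurd (h1 ▸ List.getElem_mem _) hN
    obtain ⟨h1, h2⟩ := aux_chain l u v hl1 hl2 hl3'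
    obtain ⟨x, hx1, hx2, hx3⟩ := aux_val_between u v hu1 (by omega) (by omega)
    have hxl := h2 x hx1.le hx2.le
    have := hc x hxl
    have := hlt x (hl4 x hxl) (by omega)
    omega

/-- `χ_r(→C_{2^k}) = k + 1`; in any minimal ranking exactly one vertex
receives label `k+1`, and some rotation of the ranking equals the standard ranking. -/
theorem stmt_1 (k : ℕ) (hk : 1 ≤ k) :
    rankNumber (cycleC (2 ^ k)) = k + 1 ∧
    ∀ f : ℕ → ℕ, IsRanking (cycleC (2 ^ k)) (k + 1) f →
      (∃! v, v ∈ (cycleC (2 ^ k)).verts ∧ f v = k + 1) ∧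
      ∃ r : ℕ, ∀ i ∈ Set.Icc 1 (2 ^ k),
        f ((i + r - 1) % 2 ^ k + 1) = stdCycleLabel k i := by
  have hN : 1 ≤ 2 ^ k := Nat.one_le_two_pow
  refine ⟨?_, ?_⟩
  · apply le_antisymm
    · exact Nat.sInf_le ⟨_, aux_std k⟩
    · refine le_csInf (show Set.Nonempty {K | ∃ f : ℕ → ℕ, IsRanking (cycleC (2 ^ k)) K f} from ⟨_, _, aux_std k⟩) ?_
      rintro K ⟨f, hf⟩
      exact aux_lower k K f hf
  · intro f hf
    have hmem : ∀ v, v ∈ (cycleC (2 ^ k)).verts ↔ 1 ≤ v ∧ v ≤ 2 ^ k := fun v => Iff.rfl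
    have hex : ∃ v, v ∈ (cycleC (2 ^ k)).verts ∧ f v = k + 1 := by
      by_contra hc
      push Not at hc
      have : IsRanking (cycleC (2 ^ k)) k f :=
        ⟨fun v hv => by have := hf.1 v hv; have := hc v hv; omega, hf.2⟩
      have := aux_lower k k f this
      omega
    have hkey : ∀ u v, 1 ≤ u → u < v → v ≤ 2 ^ k → f u = k + 1 → f v = k + 1 → False := by
      intro u v h1 h2 h3 h4 h5
      have eu : (u + 0 - 1) % 2 ^ k + 1 = u := by
        rw [Nat.mod_eq_of_lt (by omega)]; omega
      have ev : (v + 0 - 1) % 2 ^ k + 1 = v := by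
        rw [Nat.mod_eq_of_lt (by omega)]; omega
      obtain ⟨x, hx1, hx2, hx3⟩ := aux_between (2 ^ k) (k + 1) hN f hf 0 u v h1 h2 h3
        (by rw [eu, ev, h4, h5])
      rw [eu] at hx3
      have hm : (x + 0 - 1) % 2 ^ k < 2 ^ k := Nat.mod_lt _ (by omega)
      have := hf.1 ((x + 0 - 1) % 2 ^ k + 1) ((hmem _).2 (by omega))
      omega
    obtain ⟨p, hp, hfp⟩ := hex
    have huniq : ∀ v, v ∈ (cycleC (2 ^ k)).verts → f v = k + 1 → v = p := by
      intro v hv hfv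
      rw [hmem] at hv hp
      by_contra hne
      rcases lt_or_gt_of_ne hne with h | h
      · exact hkey v p hv.1 h hp.2 hfv hfp
      · exact hkey p v hp.1 h hv.2 hfp hfv
    refine ⟨⟨p, ⟨hp, hfp⟩, fun v hv => huniq v hv.1 hv.2⟩, p, ?_⟩
    have hp' := (hmem p).1 hp
    have hpp : (2 ^ k + p - 1) % 2 ^ k + 1 = p := by
      have : 2 ^ k + p - 1 = (p - 1) + 2 ^ k := by omega
      rw [this, Nat.add_mod_right, Nat.mod_eq_of_lt (by omega)]; omega
    have hv : ∀ t, t % 2 ^ k + 1 ∈ (cycleC (2 ^ k)).verts := by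
      intro t
      have h1 : t % 2 ^ k < 2 ^ k := Nat.mod_lt _ (by omega)
      rw [hmem]; omega
    have main := (aux_path k (2 ^ k - 1) (fun i => f ((i + p - 1) % 2 ^ k + 1))
      (fun i hi1 hi2 => by
        have h1 := hf.1 _ (hv (i + p - 1))
        refine ⟨h1.1, ?_⟩
        by_contra hc
        have h2 := huniq _ (hv (i + p - 1)) (by omega)
        have h3 : (i + p - 1) ≡ (2 ^ k + p - 1) [MOD 2 ^ k] := by
          show _ % _ = _ % _
          omega
        have hd := (Nat.modEq_iff_dvd' (by omega)).1 h3
        have := Nat.le_of_dvd (by omega) hd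
        omega)
      (fun i j a b c d => aux_between _ (k + 1) hN f hf p i j a b (by omega) d)).2 (by omega)
    intro i hi
    by_cases hik : i = 2 ^ k
    · subst hik
      rw [hpp, hfp]; simp [stdCycleLabel]
    · rw [Set.mem_Icc] at hi
      have := main i hi.1 (by omega)
      simp only [stdCycleLabel, stdLabel, hik, if_false]
      exact this
end

section
/- For every integer n ≥ 2, the direct sum graph of type I satisfies χ_r(→G_n) = χ_r(→P_{2^n−1}) = n, and →G_n has a unique minimal ranking; this minimal ranking coincides with the unique minimal ranking of →P_{2^n−1}, i.e., f(v_i) = α + 1 where 2^α is the largest power of 2 dividing i. -/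
lemma edgesI_lt_mod (n : ℕ) : ∀ a b : ℕ, (a, b) ∈ edgesI n →
    1 ≤ a ∧ a < b ∧ b < 2 ^ n ∧ ∀ m, a % 2 ^ m ≠ 0 → b % 2 ^ m ≠ 0 → a % 2 ^ m < b % 2 ^ m := by
  induction n using Nat.strong_induction_on with
  | _ n ih =>
  match n, ih with
  | 0, _ => intro a b h; simp [edgesI] at h
  | 1, _ => intro a b h; simp [edgesI] at h
  | 2, _ =>
    intro a b h
    simp only [edgesI, Set.mem_insert_iff, Set.mem_singleton_iff, Prod.mk.injEq] at h
    refine ⟨by omega, by omega, by omega, ?_⟩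
    intro m h1 h2
    match m with
    | 0 => exact absurd (by simp [Nat.mod_one]) h1
    | 1 => omega
    | m + 2 =>
      have : 4 ≤ 2 ^ (m + 2) := by rw [pow_add]; have := Nat.one_le_two_pow (n := m); omega
      rw [Nat.mod_eq_of_lt (by omega), Nat.mod_eq_of_lt (by omega)]; omega
  | n + 3, ih =>
    intro a b h
    have ih' := ih (n + 2) (by omega)
    have hp : 2 ^ (n + 3) = 2 ^ (n + 2) + 2 ^ (n + 2) := by ring
    have h4 : 4 ≤ 2 ^ (n + 2) := by rw [pow_add]; have := Nat.one_le_two_pow (n := n); omega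
    have key : 1 ≤ a ∧ a < b ∧ b < 2 ^ (n + 3) ∧ (a = 2 ^ (n + 2) ∨ b = 2 ^ (n + 2) ∨
        ∃ a' b', (a', b') ∈ edgesI (n + 2) ∧ (a = a' ∨ a = a' + 2 ^ (n + 2)) ∧
          (b = b' ∨ b = b' + 2 ^ (n + 2))) := by
      simp only [edgesI, Set.mem_union, Set.mem_image, Set.mem_insert_iff, Set.mem_singleton_iff,
        Prod.mk.injEq, Set.mem_setOf_eq, Prod.exists] at h
      rcases h with ((((h | ⟨a', b', h, rfl, rfl⟩) | h) | ⟨j, h1, h2, rfl, rfl⟩) |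
        ⟨j, h1, h2, rfl, rfl⟩) | ⟨a', b', h, rfl, rfl⟩
      · obtain ⟨h1, h2, h3, -⟩ := ih' _ _ h
        exact ⟨by omega, by omega, by omega, Or.inr (Or.inr ⟨a, b, h, by simp, by simp⟩)⟩
      · obtain ⟨h1, h2, h3, -⟩ := ih' _ _ h
        exact ⟨by omega, by omega, by omega, Or.inr (Or.inr ⟨a', b', h, by simp, by simp⟩)⟩
      · omega
      · omega
      · omega
      · obtain ⟨h1, h2, h3, -⟩ := ih' _ _ h
        exact ⟨by omega, by omega, by omega, Or.inr (Or.inr ⟨a', b', h, by simp, by simp⟩)⟩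
    obtain ⟨k1, k2, k3, k4⟩ := key
    refine ⟨k1, k2, k3, ?_⟩
    intro m h1 h2
    by_cases hm : n + 3 ≤ m
    · have : 2 ^ (n + 3) ≤ 2 ^ m := Nat.pow_le_pow_right (by norm_num) hm
      rw [Nat.mod_eq_of_lt (by omega), Nat.mod_eq_of_lt (by omega)]; omega
    · have hd : 2 ^ m ∣ 2 ^ (n + 2) := pow_dvd_pow 2 (by omega)
      have hs : ∀ x, (x + 2 ^ (n + 2)) % 2 ^ m = x % 2 ^ m := fun x => by
        rw [Nat.add_mod, Nat.mod_eq_zero_of_dvd hd]; simp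
      rcases k4 with rfl | rfl | ⟨a', b', he, ha, hb⟩
      · exact absurd (Nat.mod_eq_zero_of_dvd hd) h1
      · exact absurd (Nat.mod_eq_zero_of_dvd hd) h2
      · have e1 : a % 2 ^ m = a' % 2 ^ m := by rcases ha with rfl | rfl <;> simp [hs]
        have e2 : b % 2 ^ m = b' % 2 ^ m := by rcases hb with rfl | rfl <;> simp [hs]
        rw [e1] at h1 ⊢
        rw [e2] at h2 ⊢
        exact (ih' _ _ he).2.2.2 m h1 h2

lemma path_subset (n : ℕ) : ∀ i, 1 ≤ i → i + 1 < 2 ^ (n + 2) → (i, i + 1) ∈ edgesI (n + 2) := by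
  induction n with
  | zero => intro i h1 h2; simp [edgesI]; omega
  | succ n ih =>
    intro i h1 h2
    have hp : 2 ^ (n + 1 + 2) = 2 ^ (n + 2) + 2 ^ (n + 2) := by ring
    show (i, i + 1) ∈ edgesI (n + 3)
    simp only [edgesI, Set.mem_union, Set.mem_image, Set.mem_insert_iff, Set.mem_singleton_iff,
        Prod.mk.injEq, Set.mem_setOf_eq, Prod.exists]
    by_cases c1 : i + 1 < 2 ^ (n + 2)
    · have := ih i h1 c1
      tauto
    by_cases c2 : i ≤ 2 ^ (n + 2)
    · left; left; left; right; omega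
    · left; left; left; left; right
      exact ⟨i - 2 ^ (n + 2), i - 2 ^ (n + 2) + 1, ih _ (by omega) (by omega), by omega, by omega⟩

lemma stdLabel_eq {t i : ℕ} (h1 : 2 ^ t ∣ i) (h2 : ¬ 2 ^ (t + 1) ∣ i) : stdLabel i = t + 1 := by
  have hi : i ≠ 0 := by rintro rfl; simp at h2
  unfold stdLabel
  rw [padicValNat_dvd_iff_le hi] at h1 h2
  omega

lemma stdLabel_spec {i : ℕ} (hi : i ≠ 0) : ∃ t, stdLabel i = t + 1 ∧ 2 ^ t ∣ i ∧ ¬ 2 ^ (t + 1) ∣ i := by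
  refine ⟨padicValNat 2 i, rfl, ?_, ?_⟩ <;> rw [padicValNat_dvd_iff_le hi] <;> omega

lemma stdLabel_pow (k : ℕ) : stdLabel (2 ^ k) = k + 1 := by
  apply stdLabel_eq dvd_rfl
  intro h
  have := (Nat.pow_dvd_pow_iff_le_right (by norm_num : 1 < 2)).1 h
  omega

lemma stdLabel_add {k j : ℕ} (hj : 1 ≤ j) (hk : j < 2 ^ k) : stdLabel (2 ^ k + j) = stdLabel j := by
  obtain ⟨t, h1, h2, h3⟩ := stdLabel_spec (i := j) (by omega)
  rw [h1]
  have ht : t < k := by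
    by_contra hc
    have := Nat.le_of_dvd (by omega) h2
    have := Nat.pow_le_pow_right (n := 2) (by norm_num) (not_lt.1 hc)
    omega
  apply stdLabel_eq
  · exact (Nat.dvd_add_right (pow_dvd_pow 2 ht.le)).2 h2
  · rwa [Nat.dvd_add_right (pow_dvd_pow 2 ht)]

lemma mod_half {t i : ℕ} (h1 : 2 ^ t ∣ i) (h2 : ¬ 2 ^ (t + 1) ∣ i) : i % 2 ^ (t + 1) = 2 ^ t := by
  obtain ⟨c, rfl⟩ := h1
  rw [pow_succ, Nat.mul_mod_mul_left]
  have : c % 2 = 1 := by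
    by_contra hc
    apply h2
    rw [pow_succ]
    exact mul_dvd_mul_left _ (Nat.dvd_of_mod_eq_zero (by omega))
  rw [this, mul_one]

lemma std_ranking (n : ℕ) : IsRanking (GI n) n stdLabel := by
  refine ⟨?_, ?_⟩
  · rintro v ⟨hv1, hv2⟩
    obtain ⟨t, h1, h2, h3⟩ := stdLabel_spec (i := v) (by omega)
    refine ⟨by omega, ?_⟩
    have h4 := Nat.le_of_dvd (by omega) h2
    have : 2 ^ t < 2 ^ n := by omega
    rw [Nat.pow_lt_pow_iff_right (by norm_num)] at this
    omega
  · rintro u ⟨hu, -⟩ v ⟨hv, -⟩ hne hf l ⟨hh, hl, hc, hm⟩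
    by_contra hcon
    push Not at hcon
    obtain ⟨t, h1, h2, h3⟩ := stdLabel_spec (i := u) (by omega)
    obtain ⟨t', h1', h2', h3'⟩ := stdLabel_spec (i := v) (by omega)
    have : t' = t := by omega
    subst this
    have hnz : ∀ x ∈ l, x % 2 ^ (t' + 1) ≠ 0 := by
      intro x hx h0
      obtain ⟨hx1, -⟩ := hm x hx
      obtain ⟨s, g1, g2, g3⟩ := stdLabel_spec (i := x) (by omega)
      have := hcon x hx
      exact g3 ((pow_dvd_pow 2 (by omega)).trans (Nat.dvd_of_mod_eq_zero h0))
    have hu' := mod_half h2 h3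
    have hv' := mod_half h2' h3'
    have main : ∀ (l : List ℕ) (u : ℕ), l.head? = some u → l.getLast? = some v →
        List.IsChain (fun a b => (a, b) ∈ (GI n).edges) l →
        (∀ x ∈ l, x % 2 ^ (t' + 1) ≠ 0) → u = v ∨ u % 2 ^ (t' + 1) < v % 2 ^ (t' + 1) := by
      intro l
      induction l with
      | nil => intro u h; simp at h
      | cons x l ih =>
        intro u h1 h2 h3 h4
        simp only [List.head?_cons, Option.some.injEq] at h1
        subst h1
        cases l with
        | nil => simp at h2; exact Or.inl h2
        | cons y l =>
          right
          rw [List.isChain_cons_cons] at h3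
          have e := (edgesI_lt_mod n _ _ h3.1).2.2.2 (t' + 1) (h4 x (by simp)) (h4 y (by simp))
          rcases ih y rfl (by simpa using h2) h3.2 (fun z hz => h4 z (by simp [hz])) with r | r
          · rw [← r]; exact e
          · exact e.trans r
    rcases main l u hh hl hc hnz with h | h
    · exact hne h
    · omega

/-- Interval version of a path ranking. -/
def PR (f : ℕ → ℕ) (a L k : ℕ) : Prop :=
  (∀ j, 1 ≤ j → j ≤ L → 1 ≤ f (a + j) ∧ f (a + j) ≤ k) ∧
  ∀ i j, 1 ≤ i → i < j → j ≤ L → f (a + i) = f (a + j) →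
    ∃ x, i < x ∧ x < j ∧ f (a + i) < f (a + x)

lemma PR_split {f : ℕ → ℕ} {a L k p : ℕ} (h : PR f a L (k + 1)) (hp1 : 1 ≤ p) (hp : p ≤ L)
    (hf : f (a + p) = k + 1) : PR f a (p - 1) k ∧ PR f (a + p) (L - p) k := by
  obtain ⟨h1, h2⟩ := h
  have hu : ∀ q, 1 ≤ q → q ≤ L → q ≠ p → f (a + q) ≤ k := by
    intro q hq1 hq2 hqp
    by_contra hc
    have e := h1 q hq1 hq2
    rcases Nat.lt_or_gt_of_ne hqp with hlt | hlt
    · obtain ⟨x, x1, x2, x3⟩ := h2 q p hq1 hlt hp (by omega)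
      have := h1 x (by omega) (by omega)
      omega
    · obtain ⟨x, x1, x2, x3⟩ := h2 p q hp1 hlt hq2 (by omega)
      have := h1 x (by omega) (by omega)
      omega
  refine ⟨⟨?_, ?_⟩, ⟨?_, ?_⟩⟩
  · intro j j1 j2
    exact ⟨(h1 j j1 (by omega)).1, hu j j1 (by omega) (by omega)⟩
  · intro i j i1 i2 i3 e
    exact h2 i j i1 i2 (by omega) e
  · intro j j1 j2
    rw [add_assoc]
    exact ⟨(h1 (p + j) (by omega) (by omega)).1, hu (p + j) (by omega) (by omega) (by omega)⟩
  · intro i j i1 i2 i3 e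
    rw [add_assoc, add_assoc] at e
    obtain ⟨x, x1, x2, x3⟩ := h2 (p + i) (p + j) (by omega) (by omega) (by omega) e
    refine ⟨x - p, by omega, by omega, ?_⟩
    rw [add_assoc, add_assoc, Nat.add_sub_cancel' (by omega)]
    exact x3

lemma PR_noTop {f : ℕ → ℕ} {a L k : ℕ} (h : PR f a L (k + 1))
    (hf : ¬ ∃ p, 1 ≤ p ∧ p ≤ L ∧ f (a + p) = k + 1) : PR f a L k := by
  refine ⟨fun j j1 j2 => ⟨(h.1 j j1 j2).1, ?_⟩, h.2⟩
  have := (h.1 j j1 j2).2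
  have : f (a + j) ≠ k + 1 := fun e => hf ⟨j, j1, j2, e⟩
  omega

lemma PR_bound (f : ℕ → ℕ) (k : ℕ) : ∀ a L, PR f a L k → L < 2 ^ k := by
  induction k with
  | zero =>
    intro a L h
    by_contra hc
    have := h.1 1 le_rfl (by simp at hc; omega)
    omega
  | succ k ih =>
    intro a L h
    rw [pow_succ]
    by_cases hf : ∃ p, 1 ≤ p ∧ p ≤ L ∧ f (a + p) = k + 1
    · obtain ⟨p, p1, p2, p3⟩ := hf
      obtain ⟨s1, s2⟩ := PR_split h p1 p2 p3
      have := ih _ _ s1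
      have := ih _ _ s2
      omega
    · have := ih _ _ (PR_noTop h hf)
      omega

lemma PR_unique (f : ℕ → ℕ) (k : ℕ) : ∀ a, PR f a (2 ^ k - 1) k →
    ∀ j, 1 ≤ j → j ≤ 2 ^ k - 1 → f (a + j) = stdLabel j := by
  induction k with
  | zero => intro a h j j1 j2; simp at j2; omega
  | succ k ih =>
    intro a h j j1 j2
    have hpos : 1 ≤ 2 ^ k := Nat.one_le_two_pow
    have hp : 2 ^ (k + 1) = 2 ^ k + 2 ^ k := by ring
    by_cases hf : ∃ p, 1 ≤ p ∧ p ≤ 2 ^ (k + 1) - 1 ∧ f (a + p) = k + 1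
    · obtain ⟨p, p1, p2, p3⟩ := hf
      obtain ⟨s1, s2⟩ := PR_split h p1 p2 p3
      have b1 := PR_bound _ _ _ _ s1
      have b2 := PR_bound _ _ _ _ s2
      have hpe : p = 2 ^ k := by omega
      subst hpe
      have e2 : 2 ^ (k + 1) - 1 - 2 ^ k = 2 ^ k - 1 := by omega
      rw [e2] at s2
      rcases lt_trichotomy j (2 ^ k) with hj | hj | hj
      · exact ih _ s1 j j1 (by omega)
      · rw [hj, p3, stdLabel_pow]
      · have := ih _ s2 (j - 2 ^ k) (by omega) (by omega)
        rw [add_assoc, Nat.add_sub_cancel' (by omega)] at this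
        rw [this, ← stdLabel_add (k := k) (by omega) (by omega), Nat.add_sub_cancel' (by omega)]
    · have := PR_bound _ _ _ _ (PR_noTop h hf)
      omega

lemma PR_of_ranking {f : ℕ → ℕ} {k N : ℕ} {E : Set (ℕ × ℕ)}
    (hE : ∀ i, 1 ≤ i → i + 1 ≤ N → (i, i + 1) ∈ E)
    (h : IsRanking ⟨Set.Icc 1 N, E⟩ k f) : PR f 0 N k := by
  obtain ⟨h1, h2⟩ := h
  refine ⟨fun j j1 j2 => by simpa using h1 j ⟨j1, j2⟩, ?_⟩
  intro i j i1 i2 i3 e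
  simp only [zero_add] at e ⊢
  have hw : IsWalkFrom ⟨Set.Icc 1 N, E⟩ i j (List.range' i (j - i + 1)) := by
    refine ⟨?_, ?_, ?_, ?_⟩
    · simp [List.head?_range']
    · rw [List.getLast?_range']
      simp
      omega
    · show List.IsChain _ _
      rw [List.isChain_iff_getElem]
      intro m hm
      simp only [List.length_range'] at hm
      simp only [List.getElem_range']
      have := hE (i + m) (by omega) (by omega)
      simpa [add_assoc] using this
    · intro x hx
      simp only [List.mem_range'_1] at hx
      exact ⟨by omega, by omega⟩
  obtain ⟨x, hx, hlt⟩ := h2 i ⟨i1, by omega⟩ j ⟨by omega, i3⟩ (by omega) e _ hw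
  simp only [List.mem_range'_1] at hx
  have : x ≠ i := by rintro rfl; omega
  have : x ≠ j := by rintro rfl; omega
  exact ⟨x, by omega, by omega, hlt⟩

lemma rankNumber_eq {N n : ℕ} {E : Set (ℕ × ℕ)} (hN : N = 2 ^ n - 1)
    (hE : ∀ i, 1 ≤ i → i + 1 ≤ N → (i, i + 1) ∈ E) {g : ℕ → ℕ}
    (h : IsRanking ⟨Set.Icc 1 N, E⟩ n g) : rankNumber ⟨Set.Icc 1 N, E⟩ = n := by
  apply le_antisymm
  · exact Nat.sInf_le ⟨g, h⟩
  · refine le_csInf ⟨n, g, h⟩ ?_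
    rintro k ⟨f, hf⟩
    have := PR_bound _ _ _ _ (PR_of_ranking hE hf)
    have hle : 2 ^ n ≤ 2 ^ k := by omega
    rwa [Nat.pow_le_pow_iff_right (by norm_num)] at hle

/-- For `n ≥ 2`, `χ_r(→G_n) = χ_r(→P_{2^n−1}) = n`, and `→G_n` has a
unique minimal ranking, which coincides with the standard minimal ranking of
`→P_{2^n−1}`. -/
theorem stmt_2 (n : ℕ) (hn : 2 ≤ n) :
    rankNumber (GI n) = n ∧ rankNumber (pathP (2 ^ n - 1)) = n ∧
    IsRanking (GI n) n stdLabel ∧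
    ∀ f : ℕ → ℕ, IsRanking (GI n) n f → ∀ v ∈ (GI n).verts, f v = stdLabel v := by
  have hE : ∀ i, 1 ≤ i → i + 1 ≤ 2 ^ n - 1 → (i, i + 1) ∈ edgesI n := by
    obtain ⟨m, rfl⟩ : ∃ m, n = m + 2 := ⟨n - 2, by omega⟩
    intro i h1 h2
    exact path_subset m i h1 (by omega)
  have hstd := std_ranking n
  refine ⟨rankNumber_eq rfl hE hstd, ?_, hstd, ?_⟩
  · have hP : IsRanking (pathP (2 ^ n - 1)) n stdLabel := by
      refine ⟨hstd.1, ?_⟩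
      rintro u hu v hv hne hf l ⟨w1, w2, w3, w4⟩
      refine hstd.2 u hu v hv hne hf l ⟨w1, w2, ?_, w4⟩
      refine List.IsChain.imp ?_ w3
      rintro a b ⟨i, i1, i2, e⟩
      rw [e]
      exact hE i i1 i2
    exact rankNumber_eq rfl (fun i i1 i2 => ⟨i, i1, i2, rfl⟩) hP
  · intro f hf v hv
    have := PR_unique f n 0 (PR_of_ranking hE hf) v hv.1 hv.2
    simpa using this
end

section
/- For every integer n ≥ 2, the total number of edges of the direct sum graph of type I →G_n equals 3^n − 2^{n+1} + 1, which is twice the Stirling number of the second kind S(n+1,3). -/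
theorem step_eq (E : Set (ℕ × ℕ)) (M : ℕ) (hM : 4 ≤ M) :
    E ∪ (fun p : ℕ × ℕ => (p.1 + M, p.2 + M)) '' E ∪
      {(M - 1, M), (M, M + 1)} ∪
      {p | ∃ j, 1 ≤ j ∧ j ≤ M - 2 ∧ p = (j, M)} ∪
      {p | ∃ j, 2 ≤ j ∧ j ≤ M - 1 ∧ p = (M, M + j)} ∪
      (fun p : ℕ × ℕ => (p.1, p.2 + M)) '' E =
    E ∪ ((fun p : ℕ × ℕ => (p.1 + M, p.2 + M)) '' E ∪
      ((fun p : ℕ × ℕ => (p.1, p.2 + M)) '' E ∪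
      ((fun j : ℕ => (j, M)) '' Set.Icc 1 (M - 1) ∪
      (fun j : ℕ => (M, M + j)) '' Set.Icc 1 (M - 1)))) := by
  have h1 : {(M - 1, M), (M, M + 1)} ∪
      {p | ∃ j, 1 ≤ j ∧ j ≤ M - 2 ∧ p = (j, M)} ∪
      {p | ∃ j, 2 ≤ j ∧ j ≤ M - 1 ∧ p = (M, M + j)} =
      ((fun j : ℕ => (j, M)) '' Set.Icc 1 (M - 1) ∪
      (fun j : ℕ => (M, M + j)) '' Set.Icc 1 (M - 1)) := by
    ext ⟨a, b⟩
    simp only [Set.mem_union, Set.mem_insert_iff, Set.mem_singleton_iff, Set.mem_ofPred_eq,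
      Set.mem_image, Set.mem_Icc, Prod.mk.injEq]
    constructor
    · rintro (((⟨h, h'⟩ | ⟨h, h'⟩) | ⟨j, h⟩) | ⟨j, h⟩)
      · exact Or.inl ⟨M - 1, by omega⟩
      · exact Or.inr ⟨1, by omega⟩
      · exact Or.inl ⟨j, by omega⟩
      · exact Or.inr ⟨j, by omega⟩
    · rintro (⟨j, h⟩ | ⟨j, h⟩)
      · by_cases hj : j = M - 1
        · left; left; left; omega
        · left; right; exact ⟨j, by omega⟩
      · by_cases hj : j = 1
        · left; left; right; omega
        · right; exact ⟨j, by omega⟩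
  rw [← h1]
  ext p
  simp only [Set.mem_union]
  tauto

theorem step_card (E : Set (ℕ × ℕ)) (M : ℕ) (hM : 4 ≤ M) (hf : E.Finite)
    (hE : ∀ p ∈ E, 1 ≤ p.1 ∧ p.1 < M ∧ 1 ≤ p.2 ∧ p.2 < M) :
    (E ∪ ((fun p : ℕ × ℕ => (p.1 + M, p.2 + M)) '' E ∪
      ((fun p : ℕ × ℕ => (p.1, p.2 + M)) '' E ∪
      ((fun j : ℕ => (j, M)) '' Set.Icc 1 (M - 1) ∪
      (fun j : ℕ => (M, M + j)) '' Set.Icc 1 (M - 1))))).ncard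
    = 3 * E.ncard + 2 * (M - 1) := by
  have hI : (Set.Icc 1 (M - 1)).Finite := Set.finite_Icc _ _
  have hIc : (Set.Icc 1 (M - 1)).ncard = M - 1 := by
    rw [← Finset.coe_Icc, Set.ncard_coe_finset, Nat.card_Icc]; omega
  have fB := hI.image (fun j : ℕ => (j, M))
  have fC := hI.image (fun j : ℕ => (M, M + j))
  have f1 := hf.image (fun p : ℕ × ℕ => (p.1 + M, p.2 + M))
  have f2 := hf.image (fun p : ℕ × ℕ => (p.1, p.2 + M))
  rw [Set.ncard_union_eq _ hf (f1.union (f2.union (fB.union fC))),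
    Set.ncard_union_eq _ f1 (f2.union (fB.union fC)),
    Set.ncard_union_eq _ f2 (fB.union fC),
    Set.ncard_union_eq _ fB fC,
    Set.ncard_image_of_injective, Set.ncard_image_of_injective,
    Set.ncard_image_of_injective, Set.ncard_image_of_injective, hIc]
  · ring
  · intro a b h; simpa using h
  · intro a b h; simpa using h
  · rintro ⟨a, b⟩ ⟨c, d⟩ h; simpa using h
  · rintro ⟨a, b⟩ ⟨c, d⟩ h; simpa using h
  all_goals
    rw [Set.disjoint_left]
    rintro ⟨a, b⟩ h h'
    simp only [Set.mem_union, Set.mem_image, Set.mem_Icc, Prod.mk.injEq, Prod.exists] at h h'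
    grind

theorem edges_fin (n : ℕ) : (edgesI (n + 2)).Finite ∧
    ∀ p ∈ edgesI (n + 2), 1 ≤ p.1 ∧ p.1 < 2 ^ (n + 2) ∧ 1 ≤ p.2 ∧ p.2 < 2 ^ (n + 2) := by
  induction n with
  | zero => simp [edgesI]
  | succ n ih =>
    obtain ⟨hf, hE⟩ := ih
    have hM : 4 ≤ 2 ^ (n + 2) := by
      have := Nat.one_le_two_pow (n := n); rw [pow_add]; omega
    have h2 : 2 ^ (n + 1 + 2) = 2 * 2 ^ (n + 2) := by ring
    rw [h2, show n + 1 + 2 = n + 3 by ring, edgesI, step_eq _ _ hM]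
    generalize 2 ^ (n + 2) = M at *
    have hI : (Set.Icc 1 (M - 1)).Finite := Set.finite_Icc _ _
    refine ⟨hf.union ((hf.image _).union ((hf.image _).union ((hI.image _).union (hI.image _)))), ?_⟩
    rintro ⟨a, b⟩ h
    simp only [Set.mem_union, Set.mem_image, Set.mem_Icc, Prod.mk.injEq, Prod.exists] at h
    grind

theorem edges_card (n : ℕ) : (edgesI (n + 2)).ncard + 2 ^ (n + 3) = 3 ^ (n + 2) + 1 := by
  induction n with
  | zero =>
    have : edgesI 2 = {(1, 2), (2, 3)} := by rw [edgesI]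
    simp only [zero_add, this]
    rw [Set.ncard_pair (by simp)]; norm_num
  | succ n ih =>
    obtain ⟨hf, hE⟩ := edges_fin n
    have hM : 4 ≤ 2 ^ (n + 2) := by
      have := Nat.one_le_two_pow (n := n); rw [pow_add]; omega
    rw [show n + 1 + 2 = n + 3 by ring, edgesI, step_eq _ _ hM, step_card _ _ hM hf hE]
    have e1 : 2 ^ (n + 3) = 2 * 2 ^ (n + 2) := by ring
    have e2 : 2 ^ (n + 1 + 3) = 4 * 2 ^ (n + 2) := by ring
    have e3 : 3 ^ (n + 3) = 3 * 3 ^ (n + 2) := by ring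
    omega

theorem stir1 (n : ℕ) : stirling (n + 1) 1 = 1 := by
  induction n with
  | zero => simp [stirling]
  | succ n ih => rw [stirling, ih]; simp [stirling]

theorem stir2 (n : ℕ) : stirling (n + 1) 2 + 1 = 2 ^ n := by
  induction n with
  | zero => simp [stirling]
  | succ n ih => rw [stirling, stir1, pow_succ]; norm_num; omega

theorem stir3 (n : ℕ) : 2 * stirling (n + 1) 3 + 2 ^ (n + 1) = 3 ^ n + 1 := by
  induction n with
  | zero => simp [stirling]
  | succ n ih =>
    have := stir2 n
    have e1 : 2 ^ (n + 1) = 2 * 2 ^ n := by ring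
    have e2 : 2 ^ (n + 1 + 1) = 4 * 2 ^ n := by ring
    have e3 : 3 ^ (n + 1) = 3 * 3 ^ n := by ring
    have e4 : stirling (n + 1 + 1) 3 = 3 * stirling (n + 1) 3 + stirling (n + 1) 2 := by
      rw [stirling]
    omega

/-- For `n ≥ 2`, the number of edges of `→G_n` equals
`3^n − 2^{n+1} + 1 = 2·S(n+1,3)`. -/
theorem stmt_3 (n : ℕ) (hn : 2 ≤ n) :
    (edgesI n).ncard = 3 ^ n - 2 ^ (n + 1) + 1 ∧
    (edgesI n).ncard = 2 * stirling (n + 1) 3 := by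
  obtain ⟨m, rfl⟩ := Nat.exists_eq_add_of_le' hn
  have h1 := edges_card m
  have h2 := stir3 (m + 2)
  have h3 : 0 < (edgesI (m + 2)).ncard := by
    rw [Set.ncard_pos (edges_fin m).1]
    clear h1 h2 hn
    induction m with
    | zero => exact ⟨(1, 2), by simp [edgesI]⟩
    | succ m ih =>
      obtain ⟨p, hp⟩ := ih
      refine ⟨p, ?_⟩
      rw [show m + 1 + 2 = m + 3 by ring, edgesI]
      simp only [Set.mem_union]
      tauto
  rw [show m + 3 = m + 2 + 1 by ring] at h1
  omega
end

section
/- For every integer n ≥ 2, the total number of edges of the direct sum graph of type II ←G_n equals (n−1)·2^n. -/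
theorem stepII (S : Set (ℕ × ℕ)) (N : ℕ) (hN : 2 ≤ N)
    (hS : ∀ p ∈ S, 1 ≤ p.1 ∧ p.1 < N ∧ 1 ≤ p.2 ∧ p.2 < N) (hf : S.Finite) :
    (S ∪ (fun p : ℕ × ℕ => (p.1 + N, p.2 + N)) '' S ∪ {(N - 1, N), (N, N + 1)} ∪
      {p | ∃ j, 1 ≤ j ∧ j ≤ N - 1 ∧ p = (N, j)} ∪
      {p | ∃ j, 1 ≤ j ∧ j ≤ N - 1 ∧ p = (N + j, N)}).ncard = 2 * S.ncard + 2 * N := by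
  have e1 : {p : ℕ × ℕ | ∃ j, 1 ≤ j ∧ j ≤ N - 1 ∧ p = (N, j)} =
      (fun j => (N, j)) '' (Finset.Icc 1 (N - 1) : Set ℕ) := by
    ext p; simp [and_assoc, eq_comm]
  have e2 : {p : ℕ × ℕ | ∃ j, 1 ≤ j ∧ j ≤ N - 1 ∧ p = (N + j, N)} =
      (fun j => (N + j, N)) '' (Finset.Icc 1 (N - 1) : Set ℕ) := by
    ext p; simp [and_assoc, eq_comm]
  have f1 : {p : ℕ × ℕ | ∃ j, 1 ≤ j ∧ j ≤ N - 1 ∧ p = (N, j)}.Finite := by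
    rw [e1]; exact (Finset.finite_toSet _).image _
  have f2 : {p : ℕ × ℕ | ∃ j, 1 ≤ j ∧ j ≤ N - 1 ∧ p = (N + j, N)}.Finite := by
    rw [e2]; exact (Finset.finite_toSet _).image _
  have c1 : {p : ℕ × ℕ | ∃ j, 1 ≤ j ∧ j ≤ N - 1 ∧ p = (N, j)}.ncard = N - 1 := by
    rw [e1, Set.ncard_image_of_injective _ (fun a b h => by simpa using h), Set.ncard_coe_finset]
    simp
  have c2 : {p : ℕ × ℕ | ∃ j, 1 ≤ j ∧ j ≤ N - 1 ∧ p = (N + j, N)}.ncard = N - 1 := by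
    rw [e2, Set.ncard_image_of_injective _ (fun a b h => by simpa using h), Set.ncard_coe_finset]
    simp
  have c3 : ({(N - 1, N), (N, N + 1)} : Set (ℕ × ℕ)).ncard = 2 := by
    apply Set.ncard_pair; simp
  have f3 : ({(N - 1, N), (N, N + 1)} : Set (ℕ × ℕ)).Finite := Set.toFinite _
  have f4 : ((fun p : ℕ × ℕ => (p.1 + N, p.2 + N)) '' S).Finite := hf.image _
  have c4 : ((fun p : ℕ × ℕ => (p.1 + N, p.2 + N)) '' S).ncard = S.ncard := by
    apply Set.ncard_image_of_injective
    rintro ⟨a, b⟩ ⟨c, d⟩ h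
    simpa using h
  rw [Set.ncard_union_eq ?_ (((hf.union f4).union f3).union f1) f2,
    Set.ncard_union_eq ?_ ((hf.union f4).union f3) f1,
    Set.ncard_union_eq ?_ (hf.union f4) f3, Set.ncard_union_eq ?_ hf f4, c1, c2, c3, c4]
  · omega
  all_goals
    rw [Set.disjoint_left]
    rintro ⟨a, b⟩ h h'
    simp only [Set.mem_union, Set.mem_image, Set.mem_setOf_eq, Set.mem_insert_iff,
      Set.mem_singleton_iff, Prod.mk.injEq, Prod.exists] at h h'
    have hS' : ∀ a b, (a, b) ∈ S → 1 ≤ a ∧ a < N ∧ 1 ≤ b ∧ b < N := fun a b h => hS _ h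
    grind

theorem boundII (n : ℕ) : (edgesII (n + 2)).Finite ∧
    ∀ p ∈ edgesII (n + 2), 1 ≤ p.1 ∧ p.1 < 2 ^ (n + 2) ∧ 1 ≤ p.2 ∧ p.2 < 2 ^ (n + 2) := by
  induction n with
  | zero =>
    constructor
    · simp [edgesII]
    · rintro ⟨a, b⟩ h
      simp [edgesII] at h
      simp only [Nat.zero_add]
      omega
  | succ n ih =>
    obtain ⟨hf, hS⟩ := ih
    have hN : 4 ≤ 2 ^ (n + 2) := by
      have := Nat.one_le_two_pow (n := n)
      rw [pow_add]; omega
    have h2 : 2 ^ (n + 1 + 2) = 2 * 2 ^ (n + 2) := by ring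
    have key : ∀ p ∈ edgesII (n + 1 + 2),
        1 ≤ p.1 ∧ p.1 < 2 ^ (n + 1 + 2) ∧ 1 ≤ p.2 ∧ p.2 < 2 ^ (n + 1 + 2) := by
      rintro ⟨a, b⟩ h
      rw [h2]
      change (a, b) ∈ edgesII (n + 3) at h
      rw [edgesII] at h
      generalize 2 ^ (n + 2) = N at *
      simp only [Set.mem_union, Set.mem_image, Set.mem_setOf_eq, Set.mem_insert_iff,
        Set.mem_singleton_iff, Prod.mk.injEq, Prod.exists] at h
      have hS' : ∀ a b, (a, b) ∈ edgesII (n + 2) → 1 ≤ a ∧ a < N ∧ 1 ≤ b ∧ b < N :=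
        fun a b h => hS _ h
      grind
    refine ⟨?_, key⟩
    apply Set.Finite.subset ((Set.finite_Iio (2 ^ (n + 1 + 2))).prod
      (Set.finite_Iio (2 ^ (n + 1 + 2))))
    intro p hp
    have := key p hp
    exact ⟨this.2.1, this.2.2.2⟩

theorem countII (n : ℕ) : (edgesII (n + 2)).ncard = (n + 1) * 2 ^ (n + 2) := by
  induction n with
  | zero =>
    have : edgesII (0 + 2) = (({(1, 2), (2, 3), (2, 1), (3, 2)} : Finset (ℕ × ℕ)) : Set (ℕ × ℕ)) := by
      simp [edgesII]
    rw [this, Set.ncard_coe_finset]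
    decide
  | succ n ih =>
    have hN : 2 ≤ 2 ^ (n + 2) := by
      have := Nat.one_le_two_pow (n := n)
      rw [pow_add]; omega
    have := stepII (edgesII (n + 2)) (2 ^ (n + 2)) hN (boundII n).2 (boundII n).1
    change (edgesII (n + 3)).ncard = _
    rw [edgesII, this, ih]
    ring

/-- For `n ≥ 2`, the number of edges of `←G_n` equals `(n−1)·2^n`. -/
theorem stmt_7 (n : ℕ) (hn : 2 ≤ n) :
    (edgesII n).ncard = (n - 1) * 2 ^ n := by
  obtain ⟨m, rfl⟩ := Nat.exists_eq_add_of_le' hn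
  simpa using countII m
end

section
/- For every integer k ≥ 2, the graph →Ω_{2^k} satisfies χ_r(→Ω_{2^k}) = χ_r(→C_{2^k}) = k + 1; in particular, every edge of →Ω_{2^k} that is not an edge of →C_{2^k} is admissible for →C_{2^k}. -/
theorem aux_edge : ∀ (n a b : ℕ), (a, b) ∈ edgesI n →
    a < b ∧ b < 2 ^ n ∧ ∀ c, ¬ 2 ^ c ∣ a → ¬ 2 ^ c ∣ b → a % 2 ^ c < b % 2 ^ c
  | 0, a, b => by simp [edgesI]
  | 1, a, b => by simp [edgesI]
  | 2, a, b => by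
    intro h
    have key : ∀ x y : ℕ, x < y → y < 4 → x + 1 = y →
        ∀ c, ¬ 2 ^ c ∣ x → ¬ 2 ^ c ∣ y → x % 2 ^ c < y % 2 ^ c := by
      intro x y h1 h2 h3 c hx hy
      subst h3
      have hp : 0 < 2 ^ c := by positivity
      rw [Nat.dvd_iff_mod_eq_zero] at hy
      rw [Nat.add_mod_eq_ite] at *
      rcases Nat.lt_or_ge 1 (2 ^ c) with h | h
      · rw [Nat.mod_eq_of_lt h] at *
        have := Nat.mod_lt x hp
        split_ifs at * <;> omega
      · have : 2 ^ c = 1 := by omega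
        simp [this] at hx
    simp only [edgesI, Set.mem_insert_iff, Set.mem_singleton_iff, Prod.mk.injEq] at h
    have : a + 1 = b ∧ b < 4 := by omega
    exact ⟨by omega, by omega, key a b (by omega) this.2 this.1⟩
  | n + 3, a, b => by
    intro h
    have IH := aux_edge (n + 2)
    have hM : 2 ^ (n + 3) = 2 * 2 ^ (n + 2) := by ring
    have hpos : 4 ≤ 2 ^ (n + 2) := by
      have : 2 ^ (n + 2) = 4 * 2 ^ n := by ring
      have : 0 < 2 ^ n := by positivity
      omega
    have hbig : ∀ x y c : ℕ, x < y → y < 2 ^ (n + 3) → n + 3 ≤ c → x % 2 ^ c < y % 2 ^ c := by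
      intro x y c h1 h2 h3
      have := Nat.pow_le_pow_right (n := 2) (by norm_num) h3
      rw [Nat.mod_eq_of_lt, Nat.mod_eq_of_lt] <;> omega
    suffices hs : a < b ∧ b < 2 ^ (n + 3) ∧
        ∀ c, c ≤ n + 2 → ¬ 2 ^ c ∣ a → ¬ 2 ^ c ∣ b → a % 2 ^ c < b % 2 ^ c by
      refine ⟨hs.1, hs.2.1, fun c ha hb => ?_⟩
      rcases Nat.lt_or_ge (n + 2) c with hc | hc
      · exact hbig a b c hs.1 hs.2.1 hc
      · exact hs.2.2 c hc ha hb
    have hd : ∀ c, c ≤ n + 2 → 2 ^ c ∣ 2 ^ (n + 2) := fun c hc => pow_dvd_pow 2 hc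
    have hmod : ∀ c x, c ≤ n + 2 → (x + 2 ^ (n + 2)) % 2 ^ c = x % 2 ^ c := by
      intro c x hc
      rw [Nat.add_mod, Nat.mod_eq_zero_of_dvd (hd c hc)]; simp
    have hdv : ∀ c x, c ≤ n + 2 → (2 ^ c ∣ (x + 2 ^ (n + 2)) ↔ 2 ^ c ∣ x) := by
      intro c x hc
      rw [Nat.dvd_iff_mod_eq_zero, Nat.dvd_iff_mod_eq_zero, hmod c x hc]
    unfold edgesI at h
    rcases h with ((((h | h) | h) | h) | h) | h
    · have := IH a b h
      exact ⟨this.1, by omega, fun c _ => this.2.2 c⟩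
    · obtain ⟨⟨x, y⟩, hxy, he⟩ := h
      simp only [Prod.mk.injEq] at he
      obtain ⟨rfl, rfl⟩ := he
      have := IH x y hxy
      refine ⟨by omega, by omega, fun c hc => ?_⟩
      rw [hmod c x hc, hmod c y hc, hdv c x hc, hdv c y hc]
      exact this.2.2 c
    · simp only [Set.mem_insert_iff, Set.mem_singleton_iff, Prod.mk.injEq] at h
      refine ⟨by omega, by omega, fun c hc ha hb => ?_⟩
      rcases h with ⟨_, rfl⟩ | ⟨rfl, _⟩
      · exact absurd (hd c hc) hb
      · exact absurd (hd c hc) ha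
    · obtain ⟨j, h1, h2, he⟩ := h
      simp only [Prod.mk.injEq] at he
      obtain ⟨rfl, rfl⟩ := he
      exact ⟨by omega, by omega, fun c hc ha hb => absurd (hd c hc) hb⟩
    · obtain ⟨j, h1, h2, he⟩ := h
      simp only [Prod.mk.injEq] at he
      obtain ⟨rfl, rfl⟩ := he
      exact ⟨by omega, by omega, fun c hc ha hb => absurd (hd c hc) ha⟩
    · obtain ⟨⟨x, y⟩, hxy, he⟩ := h
      simp only [Prod.mk.injEq] at he
      obtain ⟨rfl, rfl⟩ := he
      have := IH x y hxy
      refine ⟨by omega, by omega, fun c hc => ?_⟩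
      rw [hmod c y hc, hdv c y hc]
      exact this.2.2 c

theorem aux_succ (x c : ℕ) (hx : ¬ 2 ^ c ∣ x) (hy : ¬ 2 ^ c ∣ x + 1) :
    x % 2 ^ c < (x + 1) % 2 ^ c := by
  have hp : 0 < 2 ^ c := by positivity
  rw [Nat.dvd_iff_mod_eq_zero] at hy
  rw [Nat.add_mod_eq_ite] at *
  rcases Nat.lt_or_ge 1 (2 ^ c) with h | h
  · rw [Nat.mod_eq_of_lt h] at *
    have := Nat.mod_lt x hp
    split_ifs at * <;> omega
  · have : 2 ^ c = 1 := by omega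
    simp [this] at hx

theorem aux_omega (k a b c : ℕ) (hc : c ≤ k) (h : (a, b) ∈ (OmegaI k).edges)
    (ha : ¬ 2 ^ c ∣ a) (hb : ¬ 2 ^ c ∣ b) : a % 2 ^ c < b % 2 ^ c := by
  have hd : 2 ^ c ∣ 2 ^ k := pow_dvd_pow 2 hc
  rcases h with (((⟨i, _, _, h⟩ | h) | h) | ⟨i, _, _, h⟩)
  · simp only [Prod.mk.injEq] at h
    obtain ⟨rfl, rfl⟩ := h
    exact aux_succ _ _ ha hb
  · simp only [Set.mem_singleton_iff, Prod.mk.injEq] at h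
    obtain ⟨rfl, rfl⟩ := h
    exact absurd hd ha
  · exact (aux_edge k a b h.1).2.2 c ha hb
  · simp only [Prod.mk.injEq] at h
    obtain ⟨rfl, rfl⟩ := h
    exact absurd hd ha

theorem aux_mod (u : ℕ) (hu : u ≠ 0) : u % 2 ^ (stdLabel u) = 2 ^ (stdLabel u - 1) := by
  unfold stdLabel
  set p := padicValNat 2 u with hp
  have h1 : 2 ^ p ∣ u := (padicValNat_dvd_iff_le (p := 2) hu).2 le_rfl
  have h2 : ¬ 2 ^ (p + 1) ∣ u := by
    rw [padicValNat_dvd_iff_le (p := 2) hu]; omega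
  clear_value p
  obtain ⟨m, rfl⟩ := h1
  rw [pow_succ, Nat.mul_mod_mul_left]
  rw [pow_succ, Nat.mul_dvd_mul_iff_left (by positivity)] at h2
  have : m % 2 = 1 := by omega
  simp [this]

theorem aux_upper (k : ℕ) : IsRanking (OmegaI k) (k + 1) stdLabel := by
  have hv : ∀ v ∈ (OmegaI k).verts, 1 ≤ v ∧ v ≤ 2 ^ k := fun v h => h
  have hle : ∀ v ∈ (OmegaI k).verts, 1 ≤ stdLabel v ∧ stdLabel v ≤ k + 1 := by
    intro v h
    have hv := hv v h
    have h1 : 2 ^ padicValNat 2 v ∣ v := pow_padicValNat_dvd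
    have h2 := Nat.le_of_dvd (by omega) h1
    have h3 : padicValNat 2 v ≤ k := (Nat.pow_le_pow_iff_right (a := 2) (by norm_num)).1 (by omega)
    unfold stdLabel
    omega
  refine ⟨hle, ?_⟩
  intro u hu v hvv huv hf l ⟨hhead, hlast, hchain, hmem⟩
  by_contra hcon
  push Not at hcon
  have hu0 : u ≠ 0 := by have := hv u hu; omega
  have hv0 : v ≠ 0 := by have := hv v hvv; omega
  have hc : stdLabel u ≤ k := by
    by_contra hgt
    have e1 : stdLabel u = k + 1 := by have := hle u hu; omega
    have top : ∀ w ∈ (OmegaI k).verts, stdLabel w = k + 1 → w = 2 ^ k := by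
      intro w hw he
      have hw := hv w hw
      have : 2 ^ padicValNat 2 w ∣ w := pow_padicValNat_dvd
      have e : padicValNat 2 w = k := by unfold stdLabel at he; omega
      rw [e] at this
      have := Nat.le_of_dvd (by omega) this
      omega
    exact huv ((top u hu e1).trans (top v hvv (hf ▸ e1)).symm)
  have hnd : ∀ x ∈ l, ¬ 2 ^ (stdLabel u) ∣ x := by
    intro x hx
    have hx0 : x ≠ 0 := by have := hv x (hmem x hx); omega
    have := hcon x hx
    rw [padicValNat_dvd_iff_le (p := 2) hx0]
    generalize stdLabel u = q at *
    unfold stdLabel at this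
    omega
  have hch : l.IsChain (fun a b => a % 2 ^ (stdLabel u) < b % 2 ^ (stdLabel u)) :=
    List.IsChain.imp_of_mem_imp
      (fun a b ha hb hab => aux_omega k a b _ hc hab (hnd a ha) (hnd b hb)) hchain
  haveI : IsTrans ℕ (fun a b => a % 2 ^ (stdLabel u) < b % 2 ^ (stdLabel u)) :=
    ⟨fun a b c h1 h2 => lt_trans h1 h2⟩
  have hpw := List.isChain_iff_pairwise.1 hch
  have hvl : v ∈ l := List.mem_of_getLast? hlast
  cases l with
  | nil => simp at hvl
  | cons x t =>
    simp only [List.head?_cons, Option.some.injEq] at hhead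
    subst hhead
    have hvt : v ∈ t := by
      rcases List.mem_cons.1 hvl with h | h
      · exact absurd h.symm huv
      · exact h
    have := (List.pairwise_cons.1 hpw).1 v hvt
    rw [aux_mod x hu0] at this
    rw [hf, aux_mod v hv0] at this
    exact lt_irrefl _ this

theorem aux_lower_s10 (f : ℕ → ℕ) : ∀ (j a : ℕ),
    (∀ u v, a ≤ u → u < v → v < a + 2 ^ j → f u = f v → ∃ x, u ≤ x ∧ x ≤ v ∧ f u < f x) →
    (∀ x, a ≤ x → x < a + 2 ^ j → 1 ≤ f x ∧ f x ≤ j) → False := by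
  intro j
  induction j with
  | zero => intro a _ h; have := h a le_rfl (by simp); omega
  | succ j ih =>
    intro a h1 h2
    have hp : 2 ^ (j + 1) = 2 ^ j + 2 ^ j := by ring
    have hq : 0 < 2 ^ j := by positivity
    by_cases h : ∃ x, a ≤ x ∧ x < a + 2 ^ j ∧ f x = j + 1
    · obtain ⟨x, hx1, hx2, hx3⟩ := h
      refine ih (a + 2 ^ j) (fun u v hu huv hv => h1 u v (by omega) huv (by omega)) ?_
      intro y hy1 hy2
      have hy := h2 y (by omega) (by omega)
      refine ⟨hy.1, ?_⟩
      by_contra hne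
      obtain ⟨z, hz1, hz2, hz3⟩ := h1 x y hx1 (by omega) (by omega) (by omega)
      have := h2 z (by omega) (by omega)
      omega
    · refine ih a (fun u v hu huv hv => h1 u v (by omega) huv (by omega)) ?_
      intro y hy1 hy2
      have hy := h2 y (by omega) (by omega)
      refine ⟨hy.1, ?_⟩
      by_contra hne
      exact h ⟨y, hy1, hy2, by omega⟩

theorem aux_mono (G H : DGraph) (hV : G.verts = H.verts) (hE : G.edges ⊆ H.edges) (k : ℕ)
    (f : ℕ → ℕ) (h : IsRanking H k f) : IsRanking G k f := by
  refine ⟨fun v hv => h.1 v (hV ▸ hv), ?_⟩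
  intro u hu v hv huv hf l ⟨w1, w2, w3, w4⟩
  exact h.2 u (hV ▸ hu) v (hV ▸ hv) huv hf l
    ⟨w1, w2, List.IsChain.imp (fun a b hab => hE hab) w3, fun x hx => hV ▸ w4 x hx⟩

theorem aux_path_s10 (k m : ℕ) (f : ℕ → ℕ) (h : IsRanking (pathP (2 ^ k)) m f) : k + 1 ≤ m := by
  by_contra hm
  refine aux_lower_s10 f k 1 ?_ ?_
  · intro u v hu huv hv hf
    have hU : u ∈ (pathP (2 ^ k)).verts := ⟨by omega, by omega⟩
    have hV : v ∈ (pathP (2 ^ k)).verts := ⟨by omega, by omega⟩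
    have hw : IsWalkFrom (pathP (2 ^ k)) u v (List.range' u (v - u + 1)) := by
      refine ⟨by simp [List.head?_range'], ?_, ?_, ?_⟩
      · rw [List.getLast?_range']
        simp; omega
      · refine List.IsChain.imp_of_mem_imp ?_ (List.isChain_range' u (v - u + 1) 1)
        intro a b ha hb hab
        rw [List.mem_range'_1] at ha hb
        exact ⟨a, by omega, by omega, by rw [hab]⟩
      · intro x hx
        rw [List.mem_range'_1] at hx
        exact ⟨by omega, by omega⟩
    obtain ⟨x, hx, hlt⟩ := h.2 u hU v hV (by omega) hf (List.range' u (v - u + 1)) hw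
    rw [List.mem_range'_1] at hx
    exact ⟨x, by omega, by omega, hlt⟩
  · intro x h1 h2
    have := h.1 x ⟨by omega, by omega⟩
    omega

theorem aux_main (k : ℕ) (G : DGraph) (hV : G.verts = Set.Icc 1 (2 ^ k))
    (h1 : (cycleC (2 ^ k)).edges ⊆ G.edges) (h2 : G.edges ⊆ (OmegaI k).edges) :
    rankNumber G = k + 1 := by
  have hmem : k + 1 ∈ {m | ∃ f : ℕ → ℕ, IsRanking G m f} :=
    ⟨stdLabel, aux_mono G (OmegaI k) hV h2 _ _ (aux_upper k)⟩
  refine le_antisymm (Nat.sInf_le hmem) ?_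
  refine le_csInf ⟨_, hmem⟩ ?_
  rintro m ⟨f, hf⟩
  exact aux_path_s10 k m f (aux_mono _ G hV.symm (fun e he => h1 (Or.inl he)) _ _ hf)

/-- For `k ≥ 2`, `χ_r(→Ω_{2^k}) = χ_r(→C_{2^k}) = k + 1`; in
particular every edge of `→Ω_{2^k}` not in `→C_{2^k}` is admissible for `→C_{2^k}`. -/
theorem stmt_10 (k : ℕ) (hk : 2 ≤ k) :
    rankNumber (OmegaI k) = k + 1 ∧ rankNumber (cycleC (2 ^ k)) = k + 1 ∧
    ∀ e ∈ (OmegaI k).edges \ (cycleC (2 ^ k)).edges,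
      rankNumber (addEdge (cycleC (2 ^ k)) e) = rankNumber (cycleC (2 ^ k)) := by
  have hC : (cycleC (2 ^ k)).edges ⊆ (OmegaI k).edges := fun e he => Or.inl (Or.inl he)
  have hc := aux_main k (cycleC (2 ^ k)) rfl (fun e he => he) hC
  refine ⟨aux_main k (OmegaI k) rfl hC (fun e he => he), hc, ?_⟩
  intro e he
  rw [hc]
  refine aux_main k _ rfl (fun x hx => Or.inr hx) ?_
  rintro x (rfl | hx)
  · exact he.1
  · exact hC hx
end
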